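/- arXiv:2201.04215 — 2 statements merged into one kernel-verified Lean document; each statement's English description precedes it below -/
import Mathlib

section
/- Lyapunov property for quasilinear degenerate parabolic equations. Let $a, h : [0,1]\times\mathbb{R}^2 \to \mathbb{R}$ be continuous with $a \geq 0$, let $g : [0,1]\times\mathbb{R}^2 \to \mathbb{R}$ be continuous, and let $L : [0,1]\times\mathbb{R}^2 \to \mathbb{R}$, $L = L(x,u,p)$, be twice continuously differentiable with $L_{pp}(x,u,p) = a(x,u,p)\,e^{g(x,u,p)}$ and $L_u(x,u,p) - L_{px}(x,u,p) - p\,L_{pu}(x,u,p) = -e^{g(x,u,p)}\,h(x,u,p)$ for all $(x,u,p)$. Let $T>0$ and let $u : [0,T]\times[0,1] \to \mathbb{R}$ be twice continuously differentiable, satisfy the quasilinear equation $u_t = a(x,u,u_x)\,u_{xx} + h(x,u,u_x)$ on $[0,T]\times[0,1]$, and satisfy $u_t(t,0) = u_t(t,1) = 0$ for all $t$. Then for every $t \in (0,T)$, $E(t) := \int_0^1 L(x,u(t,x),u_x(t,x))\,dx$ is differentiable with $E'(t) = -\int_0^1 e^{g(x,u,u_x)}\,u_t^2\,dx \leq 0$,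 and $E'(t) = 0$ if and only if $u_t(t,x) = 0$ for all $x \in [0,1]$. -/
open Real Set

/-- Partial derivative of `u(t,x)` with respect to time `t`. -/
noncomputable def pt (u : ℝ → ℝ → ℝ) (t x : ℝ) : ℝ := deriv (fun s => u s x) t

/-- Partial derivative of `u(t,x)` with respect to space `x`. -/
noncomputable def px (u : ℝ → ℝ → ℝ) (t x : ℝ) : ℝ := deriv (fun y => u t y) x

/-- Second partial derivative of `u(t,x)` with respect to space `x`. -/
noncomputable def pxx (u : ℝ → ℝ → ℝ) (t x : ℝ) : ℝ := deriv (fun y => px u t y) x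

/-- `L_p(x,u,p)`. -/
noncomputable def Lp (L : ℝ → ℝ → ℝ → ℝ) (x u p : ℝ) : ℝ := deriv (fun p' => L x u p') p

/-- `L_pp(x,u,p)`. -/
noncomputable def Lpp (L : ℝ → ℝ → ℝ → ℝ) (x u p : ℝ) : ℝ := deriv (fun p' => Lp L x u p') p

/-- `L_u(x,u,p)`. -/
noncomputable def Lu (L : ℝ → ℝ → ℝ → ℝ) (x u p : ℝ) : ℝ := deriv (fun u' => L x u' p) u

/-- `L_px(x,u,p)`. -/
noncomputable def Lpx (L : ℝ → ℝ → ℝ → ℝ) (x u p : ℝ) : ℝ := deriv (fun x' => Lp L x' u p) x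

/-- `L_pu(x,u,p)`. -/
noncomputable def Lpu (L : ℝ → ℝ → ℝ → ℝ) (x u p : ℝ) : ℝ := deriv (fun u' => Lp L x u' p) u

section TwoVariables

variable {f : ℝ → ℝ → ℝ}

theorem hasDerivAt_pt (hf : Differentiable ℝ (fun q : ℝ × ℝ => f q.1 q.2)) (t x : ℝ) :
    HasDerivAt (fun s => f s x) (pt f t x) t := by
  have h : DifferentiableAt ℝ (fun s => f s x) t :=
    DifferentiableAt.comp t (f := fun s : ℝ => (s, x)) (hf (t, x)) (by fun_prop)
  exact h.hasDerivAt

theorem hasDerivAt_px (hf : Differentiable ℝ (fun q : ℝ × ℝ => f q.1 q.2)) (t x : ℝ) :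
    HasDerivAt (fun y => f t y) (px f t x) x := by
  have h : DifferentiableAt ℝ (fun y => f t y) x :=
    DifferentiableAt.comp x (f := fun y : ℝ => (t, y)) (hf (t, x)) (by fun_prop)
  exact h.hasDerivAt

theorem pt_eq_fderiv (hf : Differentiable ℝ (fun q : ℝ × ℝ => f q.1 q.2)) (t x : ℝ) :
    pt f t x = fderiv ℝ (fun q : ℝ × ℝ => f q.1 q.2) (t, x) (1, 0) :=
  ((hf (t, x)).hasFDerivAt.comp_hasDerivAt (f := fun s : ℝ => (s, x)) t
    ((hasDerivAt_id t).prodMk (hasDerivAt_const t x))).deriv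

theorem px_eq_fderiv (hf : Differentiable ℝ (fun q : ℝ × ℝ => f q.1 q.2)) (t x : ℝ) :
    px f t x = fderiv ℝ (fun q : ℝ × ℝ => f q.1 q.2) (t, x) (0, 1) :=
  ((hf (t, x)).hasFDerivAt.comp_hasDerivAt (f := fun y : ℝ => (t, y)) x
    ((hasDerivAt_const x t).prodMk (hasDerivAt_id x))).deriv

theorem contDiff_pt {m n : WithTop ℕ∞} (hf : ContDiff ℝ n (fun q : ℝ × ℝ => f q.1 q.2))
    (hmn : m + 1 ≤ n) : ContDiff ℝ m (fun q : ℝ × ℝ => pt f q.1 q.2) := by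
  have hd := (hf.of_le (le_add_self.trans hmn)).differentiable one_ne_zero
  simp only [pt_eq_fderiv hd]
  exact (hf.fderiv_right hmn).clm_apply contDiff_const

theorem contDiff_px {m n : WithTop ℕ∞} (hf : ContDiff ℝ n (fun q : ℝ × ℝ => f q.1 q.2))
    (hmn : m + 1 ≤ n) : ContDiff ℝ m (fun q : ℝ × ℝ => px f q.1 q.2) := by
  have hd := (hf.of_le (le_add_self.trans hmn)).differentiable one_ne_zero
  simp only [px_eq_fderiv hd]
  exact (hf.fderiv_right hmn).clm_apply contDiff_const

/-- Mixed partial derivatives of a `C²` function commute. -/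
theorem pt_px_eq_px_pt (hf : ContDiff ℝ 2 (fun q : ℝ × ℝ => f q.1 q.2)) (t x : ℝ) :
    pt (px f) t x = px (pt f) t x := by
  have hd := hf.differentiable two_ne_zero
  have hd' := (hf.fderiv_right (m := 1) (by norm_num [one_add_one_eq_two])).differentiable
    one_ne_zero
  have hx := (contDiff_px (m := 1) hf (by norm_num [one_add_one_eq_two])).differentiable one_ne_zero
  have ht := (contDiff_pt (m := 1) hf (by norm_num [one_add_one_eq_two])).differentiable one_ne_zero
  have key (v : ℝ × ℝ) : fderiv ℝ (fun q => fderiv ℝ (fun q : ℝ × ℝ => f q.1 q.2) q v) (t, x) =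
      (fderiv ℝ (fderiv ℝ (fun q : ℝ × ℝ => f q.1 q.2)) (t, x)).flip v := by
    ext <;> simp [fderiv_clm_apply (hd' (t, x)) (differentiableAt_const v)]
  rw [pt_eq_fderiv hx, px_eq_fderiv ht]
  simp only [px_eq_fderiv hd, pt_eq_fderiv hd, Prod.mk.eta, key, ContinuousLinearMap.flip_apply]
  exact (hf.contDiffAt.isSymmSndFDerivAt (by simp)) _ _

/-- Differentiation under the integral sign for a `C¹` integrand. -/
theorem hasDerivAt_intervalIntegral_of_contDiff
    (hf : ContDiff ℝ 1 (fun q : ℝ × ℝ => f q.1 q.2)) (a b t : ℝ) :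
    HasDerivAt (fun s => ∫ x in a..b, f s x) (∫ x in a..b, pt f t x) t := by
  have hc : Continuous (fun q : ℝ × ℝ => f q.1 q.2) := hf.continuous
  have hc' : Continuous (fun q : ℝ × ℝ => pt f q.1 q.2) :=
    (contDiff_pt (m := 0) hf (by simp)).continuous
  have hsec (s : ℝ) : Continuous (f s) := hc.comp (by fun_prop : Continuous fun x : ℝ => (s, x))
  have hsec' (s : ℝ) : Continuous (pt f s) :=
    hc'.comp (by fun_prop : Continuous fun x : ℝ => (s, x))
  obtain ⟨C, hC⟩ := ((isCompact_closedBall t 1).prod (isCompact_uIcc (a := a) (b := b)))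
    |>.exists_bound_of_continuousOn hc'.continuousOn
  refine (intervalIntegral.hasDerivAt_integral_of_dominated_loc_of_deriv_le
    (bound := fun _ => C) (F' := pt f) (Metric.closedBall_mem_nhds t one_pos)
    (.of_forall fun s => (hsec s).aestronglyMeasurable) ((hsec t).intervalIntegrable a b)
    (hsec' t).aestronglyMeasurable
    (.of_forall fun x hx s hs => hC (s, x) ⟨hs, uIoc_subset_uIcc hx⟩)
    intervalIntegrable_const
    (.of_forall fun x _ s _ => hasDerivAt_pt (hf.differentiable one_ne_zero) s x)).2

end TwoVariables

section ThreeVariables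

variable {G : ℝ → ℝ → ℝ → ℝ}

/-- Chain rule for a function of three real variables along a curve. -/
theorem hasDerivAt_comp_curve
    (hG : Differentiable ℝ (fun v : ℝ × ℝ × ℝ => G v.1 v.2.1 v.2.2))
    {α β γ : ℝ → ℝ} {α' β' γ' s : ℝ} (hα : HasDerivAt α α' s) (hβ : HasDerivAt β β' s)
    (hγ : HasDerivAt γ γ' s) :
    HasDerivAt (fun r => G (α r) (β r) (γ r))
      (α' * deriv (fun x => G x (β s) (γ s)) (α s) + β' * Lu G (α s) (β s) (γ s)
        + γ' * Lp G (α s) (β s) (γ s)) s := by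
  have hd := (hG (α s, β s, γ s)).hasFDerivAt
  have h1 := (hd.comp_hasDerivAt (f := fun x : ℝ => (x, β s, γ s)) (α s)
    ((hasDerivAt_id _).prodMk (hasDerivAt_const _ _))).deriv
  have h2 := (hd.comp_hasDerivAt (f := fun y : ℝ => (α s, y, γ s)) (β s)
    ((hasDerivAt_const _ _).prodMk ((hasDerivAt_id _).prodMk (hasDerivAt_const _ _)))).deriv
  have h3 := (hd.comp_hasDerivAt (f := fun z : ℝ => (α s, β s, z)) (γ s)
    ((hasDerivAt_const _ _).prodMk ((hasDerivAt_const _ _).prodMk (hasDerivAt_id _)))).deriv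
  have h := hd.comp_hasDerivAt (f := fun r => (α r, β r, γ r)) s (hα.prodMk (hβ.prodMk hγ))
  simp only [Function.comp_def] at h1 h2 h3 h
  refine h.congr_deriv ?_
  rw [Lu, Lp, h1, h2, h3, ← smul_eq_mul, ← smul_eq_mul, ← smul_eq_mul, ← map_smul, ← map_smul,
    ← map_smul, ← map_add, ← map_add]
  simp

theorem contDiff_Lp {m n : WithTop ℕ∞}
    (hG : ContDiff ℝ n (fun v : ℝ × ℝ × ℝ => G v.1 v.2.1 v.2.2)) (hmn : m + 1 ≤ n) :
    ContDiff ℝ m (fun v : ℝ × ℝ × ℝ => Lp G v.1 v.2.1 v.2.2) := by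
  have hd := (hG.of_le (le_add_self.trans hmn)).differentiable one_ne_zero
  have h (v : ℝ × ℝ × ℝ) : Lp G v.1 v.2.1 v.2.2 =
      fderiv ℝ (fun v : ℝ × ℝ × ℝ => G v.1 v.2.1 v.2.2) v (0, 0, 1) :=
    ((hd v).hasFDerivAt.comp_hasDerivAt (f := fun z : ℝ => (v.1, v.2.1, z)) v.2.2
      ((hasDerivAt_const _ _).prodMk ((hasDerivAt_const _ _).prodMk (hasDerivAt_id _)))).deriv
  simp only [h]
  exact (hG.fderiv_right hmn).clm_apply contDiff_const

theorem contDiff_Lu {m n : WithTop ℕ∞}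
    (hG : ContDiff ℝ n (fun v : ℝ × ℝ × ℝ => G v.1 v.2.1 v.2.2)) (hmn : m + 1 ≤ n) :
    ContDiff ℝ m (fun v : ℝ × ℝ × ℝ => Lu G v.1 v.2.1 v.2.2) := by
  have hd := (hG.of_le (le_add_self.trans hmn)).differentiable one_ne_zero
  have h (v : ℝ × ℝ × ℝ) : Lu G v.1 v.2.1 v.2.2 =
      fderiv ℝ (fun v : ℝ × ℝ × ℝ => G v.1 v.2.1 v.2.2) v (0, 1, 0) :=
    ((hd v).hasFDerivAt.comp_hasDerivAt (f := fun y : ℝ => (v.1, y, v.2.2)) v.2.1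
      ((hasDerivAt_const _ _).prodMk ((hasDerivAt_id _).prodMk (hasDerivAt_const _ _)))).deriv
  simp only [h]
  exact (hG.fderiv_right hmn).clm_apply contDiff_const

end ThreeVariables

/-- A continuous nonnegative weighted square integrates to zero iff the squared function
vanishes. -/
theorem intervalIntegral_mul_sq_eq_zero_iff {w f : ℝ → ℝ} {a b : ℝ} (hab : a < b)
    (hw : Continuous w) (hw0 : ∀ x, 0 < w x) (hf : Continuous f) :
    ∫ x in a..b, w x * f x ^ 2 = 0 ↔ ∀ x ∈ Icc a b, f x = 0 := by
  constructor
  · intro h x hx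
    by_contra hne
    have hpos : 0 < ∫ x in a..b, w x * f x ^ 2 :=
      intervalIntegral.integral_pos hab (by fun_prop)
        (fun y _ => mul_nonneg (hw0 y).le (sq_nonneg _))
        ⟨x, hx, mul_pos (hw0 x) (by positivity)⟩
    exact hpos.ne' h
  · intro h
    rw [intervalIntegral.integral_congr (g := fun _ => 0)]
    · simp
    · intro x hx
      rw [uIcc_of_le hab.le] at hx
      simp [h x hx]

/-- Lyapunov property for quasilinear degenerate parabolic equations. -/
theorem lyapunov_quasilinear_degenerate
    (a h : ℝ → ℝ → ℝ → ℝ)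
    (ha : Continuous (fun v : ℝ × ℝ × ℝ => a v.1 v.2.1 v.2.2))
    (ha0 : ∀ x ∈ Icc (0:ℝ) 1, ∀ u p : ℝ, 0 ≤ a x u p)
    (hh : Continuous (fun v : ℝ × ℝ × ℝ => h v.1 v.2.1 v.2.2))
    (g : ℝ → ℝ → ℝ → ℝ)
    (hg : Continuous (fun v : ℝ × ℝ × ℝ => g v.1 v.2.1 v.2.2))
    (L : ℝ → ℝ → ℝ → ℝ)
    (hL : ContDiff ℝ 2 (fun v : ℝ × ℝ × ℝ => L v.1 v.2.1 v.2.2))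
    (hLpp : ∀ x ∈ Icc (0:ℝ) 1, ∀ u p : ℝ,
      Lpp L x u p = a x u p * Real.exp (g x u p))
    (hLid : ∀ x ∈ Icc (0:ℝ) 1, ∀ u p : ℝ,
      Lu L x u p - Lpx L x u p - p * Lpu L x u p = -Real.exp (g x u p) * h x u p)
    (T : ℝ) (hT : 0 < T)
    (u : ℝ → ℝ → ℝ)
    (hu : ContDiff ℝ 2 (fun q : ℝ × ℝ => u q.1 q.2))
    (hPDE : ∀ t ∈ Icc (0:ℝ) T, ∀ x ∈ Icc (0:ℝ) 1,
      pt u t x = a x (u t x) (px u t x) * pxx u t x + h x (u t x) (px u t x))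
    (hBC : ∀ t ∈ Icc (0:ℝ) T, pt u t 0 = 0 ∧ pt u t 1 = 0) :
    ∀ t ∈ Ioo (0:ℝ) T,
      HasDerivAt (fun s => ∫ x in (0:ℝ)..1, L x (u s x) (px u s x))
        (-∫ x in (0:ℝ)..1, Real.exp (g x (u t x) (px u t x)) * (pt u t x) ^ 2) t ∧
      (-∫ x in (0:ℝ)..1, Real.exp (g x (u t x) (px u t x)) * (pt u t x) ^ 2) ≤ 0 ∧
      ((-∫ x in (0:ℝ)..1, Real.exp (g x (u t x) (px u t x)) * (pt u t x) ^ 2) = 0 ↔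
        ∀ x ∈ Icc (0:ℝ) 1, pt u t x = 0) := by
  intro t ht
  have ht' : t ∈ Icc (0 : ℝ) T := Ioo_subset_Icc_self ht
  have h12 : (1 : WithTop ℕ∞) + 1 ≤ 2 := by norm_num [one_add_one_eq_two]
  have hux := contDiff_px (m := 1) hu h12
  have hut := contDiff_pt (m := 1) hu h12
  have hLp := contDiff_Lp (m := 1) hL h12
  have hLu := contDiff_Lu (m := 1) hL h12
  have hud := hu.differentiable two_ne_zero
  have huxd := hux.differentiable one_ne_zero
  have hutd := hut.differentiable one_ne_zero
  have hLd := hL.differentiable two_ne_zero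
  have hLpd := hLp.differentiable one_ne_zero
  have hline {f : ℝ → ℝ → ℝ} (hf : Continuous (fun q : ℝ × ℝ => f q.1 q.2)) : Continuous (f t) :=
    hf.comp (by fun_prop : Continuous fun x : ℝ => (t, x))
  have hjet : Continuous (fun x => (x, u t x, px u t x)) :=
    continuous_id.prodMk ((hline hu.continuous).prodMk (hline hux.continuous))
  have hcut : Continuous (pt u t) := hline hut.continuous
  have hcutx : Continuous (px (pt u) t) :=
    hline (contDiff_px (m := 0) hut (by simp)).continuous
  have hw : Continuous (fun x => Real.exp (g x (u t x) (px u t x))) :=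
    Real.continuous_exp.comp (hg.comp hjet)
  have hcLu : Continuous (fun x => Lu L x (u t x) (px u t x)) := hLu.continuous.comp hjet
  have hcLp : ContDiff ℝ 1 (fun x => Lp L x (u t x) (px u t x)) :=
    hLp.comp (contDiff_id.prodMk
      (((hu.of_le one_le_two).comp (contDiff_const.prodMk contDiff_id)).prodMk
        (hux.comp (contDiff_const.prodMk contDiff_id))))
  have hflux (x : ℝ) : HasDerivAt (fun x => Lp L x (u t x) (px u t x))
      (1 * Lpx L x (u t x) (px u t x) + px u t x * Lpu L x (u t x) (px u t x)
        + pxx u t x * Lpp L x (u t x) (px u t x)) x :=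
    hasDerivAt_comp_curve hLpd (hasDerivAt_id x) (hasDerivAt_px hud t x) (hasDerivAt_px huxd t x)
  have hint : ContDiff ℝ 1 (fun q : ℝ × ℝ => L q.2 (u q.1 q.2) (px u q.1 q.2)) :=
    (hL.of_le one_le_two).comp (contDiff_snd.prodMk ((hu.of_le one_le_two).prodMk hux))
  have hder (x : ℝ) : pt (fun s x => L x (u s x) (px u s x)) t x =
      Lu L x (u t x) (px u t x) * pt u t x + Lp L x (u t x) (px u t x) * px (pt u) t x := by
    have := (hasDerivAt_comp_curve hLd (hasDerivAt_const t x) (hasDerivAt_pt hud t x)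
      (hasDerivAt_pt huxd t x)).deriv
    rw [pt, this, pt_px_eq_px_pt hu]
    ring
  have hcflux : Continuous (deriv fun x => Lp L x (u t x) (px u t x)) :=
    hcLp.continuous_deriv le_rfl
  have hi1 : IntervalIntegrable (fun x => Lu L x (u t x) (px u t x) * pt u t x)
      MeasureTheory.volume 0 1 := (hcLu.mul hcut).intervalIntegrable _ _
  have hi2 : IntervalIntegrable (fun x => Lp L x (u t x) (px u t x) * px (pt u) t x)
      MeasureTheory.volume 0 1 := (hcLp.continuous.mul hcutx).intervalIntegrable _ _
  have hi3 : IntervalIntegrable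
      (fun x => deriv (fun x => Lp L x (u t x) (px u t x)) x * pt u t x)
      MeasureTheory.volume 0 1 := (hcflux.mul hcut).intervalIntegrable _ _
  have hparts : ∫ x in (0 : ℝ)..1, Lp L x (u t x) (px u t x) * px (pt u) t x =
      -∫ x in (0 : ℝ)..1, deriv (fun x => Lp L x (u t x) (px u t x)) x * pt u t x := by
    rw [intervalIntegral.integral_mul_deriv_eq_deriv_mul
      (fun x _ => (hflux x).differentiableAt.hasDerivAt) (fun x _ => hasDerivAt_px hutd t x)
      (hcflux.intervalIntegrable _ _) (hcutx.intervalIntegrable _ _)]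
    simp [hBC t ht']
  have henergy : ∫ x in (0 : ℝ)..1, pt (fun s x => L x (u s x) (px u s x)) t x =
      -∫ x in (0 : ℝ)..1, Real.exp (g x (u t x) (px u t x)) * (pt u t x) ^ 2 := by
    simp only [hder]
    rw [intervalIntegral.integral_add hi1 hi2, hparts, ← sub_eq_add_neg,
      ← intervalIntegral.integral_sub hi1 hi3, ← intervalIntegral.integral_neg]
    refine intervalIntegral.integral_congr fun x hx => ?_
    rw [uIcc_of_le zero_le_one] at hx
    simp only [(hflux x).deriv, hLpp x hx]
    linear_combination pt u t x * hLid x hx (u t x) (px u t x)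
      + Real.exp (g x (u t x) (px u t x)) * pt u t x * hPDE t ht' x hx
  refine ⟨henergy ▸ hasDerivAt_intervalIntegral_of_contDiff hint 0 1 t, ?_, ?_⟩
  · exact neg_nonpos.2 (intervalIntegral.integral_nonneg zero_le_one fun x _ => by positivity)
  · rw [neg_eq_zero]
    exact intervalIntegral_mul_sq_eq_zero_iff zero_lt_one hw (fun x => Real.exp_pos _) hcut
end

section
/- A new energy formula for the porous medium equation. Let $m \in \mathbb{R}$ with $m \geq 1$, let $T>0$, and let $u : [0,T]\times[0,1] \to \mathbb{R}$ be twice continuously differentiable with $u(t,x) > 0$ and $u_x(t,x) \neq 0$ for all $(t,x) \in [0,T]\times[0,1]$, satisfying the porous medium equation in the form $u_t = m\,u^{m-1}\,u_{xx} + m(m-1)\,u^{m-2}\,u_x^2$ (that is, $u_t = (u^m)_{xx}$) on $[0,T]\times[0,1]$, and satisfying $u_t(t,0) = u_t(t,1) = 0$ for all $t$. Then for every $t \in (0,T)$, the energy $E(t) := \int_0^1 m\,u^{m-1}\,|u_x|\,\big(\log|u_x| - 1\big)\,dx$ is differentiable and $E'(t) = -\int_0^1 \frac{u_t(t,x)^2}{|u_x(t,x)|}\,dx$.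 -/
open Real Set

/-- The restriction of a differentiable function on the plane to a horizontal line. -/
theorem hasDerivAt_fst_slice {g : ℝ × ℝ → ℝ} {t x : ℝ} (hg : DifferentiableAt ℝ g (t, x)) :
    HasDerivAt (fun s => g (s, x)) (fderiv ℝ g (t, x) (1, 0)) t :=
  hg.hasFDerivAt.comp_hasDerivAt t ((hasDerivAt_id t).prodMk (hasDerivAt_const t x))

/-- The restriction of a differentiable function on the plane to a vertical line. -/
theorem hasDerivAt_snd_slice {g : ℝ × ℝ → ℝ} {t x : ℝ} (hg : DifferentiableAt ℝ g (t, x)) :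
    HasDerivAt (fun y => g (t, y)) (fderiv ℝ g (t, x) (0, 1)) x :=
  hg.hasFDerivAt.comp_hasDerivAt x ((hasDerivAt_const x t).prodMk (hasDerivAt_id x))

/-- The mixed second partial derivatives of a `C²` function on the plane agree. -/
theorem fderiv_fderiv_apply_comm {f : ℝ × ℝ → ℝ} (hf : ContDiff ℝ 2 f) (q v w : ℝ × ℝ) :
    fderiv ℝ (fun z => fderiv ℝ f z v) q w = fderiv ℝ (fun z => fderiv ℝ f z w) q v := by
  have hd : DifferentiableAt ℝ (fderiv ℝ f) q :=
    ((hf.fderiv_right (m := 1) (by norm_num)).differentiable (by norm_num)) q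
  have key (a b : ℝ × ℝ) :
      fderiv ℝ (fun z => fderiv ℝ f z a) q b = fderiv ℝ (fderiv ℝ f) q b a := by
    rw [fderiv_clm_apply hd (differentiableAt_const a)]
    simp
  rw [key, key]
  exact (hf.contDiffAt.isSymmSndFDerivAt (by simp)) w v

/-- Differentiation under the integral sign over a compact interval, for an integrand and a
parameter derivative which are jointly continuous on a closed rectangle. -/
theorem hasDerivAt_intervalIntegral_of_continuousOn {e e' : ℝ × ℝ → ℝ} {a b c d t : ℝ}
    (hcd : c ≤ d) (ht : t ∈ Ioo a b)
    (he : ContinuousOn e (Icc a b ×ˢ Icc c d)) (he' : ContinuousOn e' (Icc a b ×ˢ Icc c d))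
    (hd : ∀ s ∈ Ioo a b, ∀ x ∈ Icc c d, HasDerivAt (fun r => e (r, x)) (e' (s, x)) s) :
    HasDerivAt (fun s => ∫ x in c..d, e (s, x)) (∫ x in c..d, e' (t, x)) t := by
  have slice {g : ℝ × ℝ → ℝ} (hg : ContinuousOn g (Icc a b ×ˢ Icc c d)) {s : ℝ}
      (hs : s ∈ Ioo a b) : IntervalIntegrable (fun x => g (s, x)) MeasureTheory.volume c d := by
    apply ContinuousOn.intervalIntegrable
    rw [uIcc_of_le hcd]
    exact hg.comp (by fun_prop) fun x hx => ⟨Ioo_subset_Icc_self hs, hx⟩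
  obtain ⟨C, hC⟩ := (isCompact_Icc.prod isCompact_Icc).exists_bound_of_continuousOn he'
  have hmem {x : ℝ} (hx : x ∈ uIoc c d) : x ∈ Icc c d := by
    rw [uIoc_of_le hcd] at hx
    exact Ioc_subset_Icc_self hx
  refine (intervalIntegral.hasDerivAt_integral_of_dominated_loc_of_deriv_le
    (F := fun s x => e (s, x)) (F' := fun s x => e' (s, x)) (bound := fun _ => C)
    (Ioo_mem_nhds ht.1 ht.2) ?_ (slice he ht) (slice he' ht).def'.aestronglyMeasurable ?_
    intervalIntegrable_const ?_).2
  · filter_upwards [Ioo_mem_nhds ht.1 ht.2] with s hs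
    exact (slice he hs).def'.aestronglyMeasurable
  · exact .of_forall fun x hx s hs => hC (s, x) ⟨Ioo_subset_Icc_self hs, hmem hx⟩
  · exact .of_forall fun x hx s hs => hd s hs x (hmem hx)

/-- A nonvanishing continuous function on a rectangle has a constant sign. -/
theorem exists_abs_eq_mul_of_ne_zero {P : ℝ × ℝ → ℝ} {a b c d : ℝ}
    (hP : ContinuousOn P (Icc a b ×ˢ Icc c d)) (h0 : ∀ q ∈ Icc a b ×ˢ Icc c d, P q ≠ 0) :
    ∃ σ : ℝ, (σ = 1 ∨ σ = -1) ∧ ∀ q ∈ Icc a b ×ˢ Icc c d, |P q| = σ * P q := by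
  rcases (isPreconnected_Icc.prod isPreconnected_Icc).eq_or_eq_neg_of_sq_eq hP.abs hP
    (fun q _ => by simp) (fun {q} hq => h0 q hq) with h | h
  · exact ⟨1, .inl rfl, fun q hq => by simpa using h hq⟩
  · exact ⟨-1, .inr rfl, fun q hq => by simpa using h hq⟩

/-- A new energy formula for the porous medium equation. -/
theorem new_energy_porous_medium
    (m : ℝ) (hm : 1 ≤ m)
    (T : ℝ) (hT : 0 < T)
    (u : ℝ → ℝ → ℝ)
    (hu : ContDiff ℝ 2 (fun q : ℝ × ℝ => u q.1 q.2))
    (hupos : ∀ t ∈ Icc (0:ℝ) T, ∀ x ∈ Icc (0:ℝ) 1, 0 < u t x)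
    (huxne : ∀ t ∈ Icc (0:ℝ) T, ∀ x ∈ Icc (0:ℝ) 1, px u t x ≠ 0)
    (hPDE : ∀ t ∈ Icc (0:ℝ) T, ∀ x ∈ Icc (0:ℝ) 1,
      pt u t x = m * (u t x) ^ (m - 1) * pxx u t x
        + m * (m - 1) * (u t x) ^ (m - 2) * (px u t x) ^ 2)
    (hBC : ∀ t ∈ Icc (0:ℝ) T, pt u t 0 = 0 ∧ pt u t 1 = 0) :
    ∀ t ∈ Ioo (0:ℝ) T,
      HasDerivAt
        (fun s => ∫ x in (0:ℝ)..1,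
          m * (u s x) ^ (m - 1) * |px u s x| * (Real.log |px u s x| - 1))
        (-∫ x in (0:ℝ)..1, (pt u t x) ^ 2 / |px u t x|) t := by
  intro t ht
  set f : ℝ × ℝ → ℝ := fun q => u q.1 q.2
  set P : ℝ × ℝ → ℝ := fun q => fderiv ℝ f q (0, 1)
  set Q : ℝ × ℝ → ℝ := fun q => fderiv ℝ f q (1, 0)
  set W : ℝ × ℝ → ℝ := fun q => fderiv ℝ P q (1, 0)
  set Z : ℝ × ℝ → ℝ := fun q => fderiv ℝ P q (0, 1)
  have hf' : ContDiff ℝ 1 (fderiv ℝ f) := hu.fderiv_right (by norm_num)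
  have hP1 : ContDiff ℝ 1 P := hf'.clm_apply contDiff_const
  have hQ1 : ContDiff ℝ 1 Q := hf'.clm_apply contDiff_const
  have hfd : Differentiable ℝ f := hu.differentiable (by norm_num)
  have hPd : Differentiable ℝ P := hP1.differentiable (by norm_num)
  have hQd : Differentiable ℝ Q := hQ1.differentiable (by norm_num)
  have hP' : Continuous (fderiv ℝ P) := hP1.continuous_fderiv (by norm_num)
  have hW : Continuous W := hP'.clm_apply continuous_const
  have hZ : Continuous Z := hP'.clm_apply continuous_const
  have hpx (s x : ℝ) : px u s x = P (s, x) := (hasDerivAt_snd_slice (hfd (s, x))).deriv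
  have hpt (s x : ℝ) : pt u s x = Q (s, x) := (hasDerivAt_fst_slice (hfd (s, x))).deriv
  have hpxx (s x : ℝ) : pxx u s x = Z (s, x) := by
    simp only [pxx, hpx]
    exact (hasDerivAt_snd_slice (hPd (s, x))).deriv
  simp only [hpx, hpt, hpxx] at huxne hPDE hBC ⊢
  have hP0 : ∀ q ∈ Icc 0 T ×ˢ Icc (0 : ℝ) 1, P q ≠ 0 := fun q hq => huxne q.1 hq.1 q.2 hq.2
  have hf0 : ∀ q ∈ Icc 0 T ×ˢ Icc (0 : ℝ) 1, f q ≠ 0 := fun q hq => (hupos q.1 hq.1 q.2 hq.2).ne'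
  obtain ⟨σ, hσ, habs⟩ := exists_abs_eq_mul_of_ne_zero hP1.continuous.continuousOn hP0
  have hrpow (r : ℝ) : ContinuousOn (fun q => f q ^ r) (Icc 0 T ×ˢ Icc (0 : ℝ) 1) :=
    hfd.continuous.continuousOn.rpow_const fun q hq => .inl (hf0 q hq)
  have hlog : ContinuousOn (fun q => log (P q)) (Icc 0 T ×ˢ Icc (0 : ℝ) 1) :=
    hP1.continuous.continuousOn.log hP0
  have hPc := hP1.continuous.continuousOn (s := Icc 0 T ×ˢ Icc (0 : ℝ) 1)
  have hQc := hQ1.continuous.continuousOn (s := Icc 0 T ×ˢ Icc (0 : ℝ) 1)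
  have hWc := hW.continuousOn (s := Icc 0 T ×ˢ Icc (0 : ℝ) 1)
  have hZc := hZ.continuousOn (s := Icc 0 T ×ˢ Icc (0 : ℝ) 1)
  set e : ℝ × ℝ → ℝ := fun q => m * f q ^ (m - 1) * (σ * P q) * (log (P q) - 1) with he
  set B : ℝ × ℝ → ℝ := fun q =>
    σ * (m * (m - 1) * f q ^ (m - 2) * Q q * P q * (log (P q) - 1)) with hB
  set A : ℝ × ℝ → ℝ := fun q => σ * (m * f q ^ (m - 1) * log (P q)) with hA
  set A' : ℝ × ℝ → ℝ := fun q =>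
    σ * (m * (m - 1) * f q ^ (m - 2) * P q * log (P q) + m * f q ^ (m - 1) * (Z q / P q)) with hA'
  have hec : ContinuousOn e (Icc 0 T ×ˢ Icc (0 : ℝ) 1) :=
    ((continuousOn_const.mul (hrpow _)).mul (continuousOn_const.mul hPc)).mul
      (hlog.sub continuousOn_const)
  have hBc : ContinuousOn B (Icc 0 T ×ˢ Icc (0 : ℝ) 1) :=
    continuousOn_const.mul ((((continuousOn_const.mul (hrpow _)).mul hQc).mul hPc).mul
      (hlog.sub continuousOn_const))
  have hAc : ContinuousOn A (Icc 0 T ×ˢ Icc (0 : ℝ) 1) :=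
    continuousOn_const.mul ((continuousOn_const.mul (hrpow _)).mul hlog)
  have hA'c : ContinuousOn A' (Icc 0 T ×ˢ Icc (0 : ℝ) 1) :=
    continuousOn_const.mul ((((continuousOn_const.mul (hrpow _)).mul hPc).mul hlog).add
      ((continuousOn_const.mul (hrpow _)).mul (hZc.div hPc hP0)))
  have htI : t ∈ Icc 0 T := Ioo_subset_Icc_self ht
  have hexp : m - 1 - 1 = m - 2 := by ring
  have hleib := hasDerivAt_intervalIntegral_of_continuousOn (e := e)
    (e' := fun q => B q + A q * W q) zero_le_one ht hec (hBc.add (hAc.mul hWc))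
    fun s hs x hx => by
      have hq : (s, x) ∈ Icc 0 T ×ˢ Icc (0 : ℝ) 1 := ⟨Ioo_subset_Icc_self hs, hx⟩
      have h1 := (hasDerivAt_fst_slice (hfd (s, x))).rpow_const (p := m - 1) (.inl (hf0 _ hq))
      have h2 := hasDerivAt_fst_slice (hPd (s, x))
      have h3 := h2.log (hP0 _ hq)
      rw [hexp] at h1
      refine (((h1.const_mul m).mul (h2.const_mul σ)).mul (h3.sub_const 1)).congr_deriv ?_
      have := hP0 _ hq
      change (m * (Q (s, x) * (m - 1) * f (s, x) ^ (m - 2)) * (σ * P (s, x)) +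
        m * f (s, x) ^ (m - 1) * (σ * W (s, x))) * (log (P (s, x)) - 1) +
        m * f (s, x) ^ (m - 1) * (σ * P (s, x)) * (W (s, x) / P (s, x)) = B (s, x) + A (s, x) * W (s, x)
      simp only [hB, hA]
      field_simp
      ring
  have slice {g : ℝ × ℝ → ℝ} (hg : ContinuousOn g (Icc 0 T ×ˢ Icc (0 : ℝ) 1)) :
      IntervalIntegrable (fun x => g (t, x)) MeasureTheory.volume 0 1 := by
    apply ContinuousOn.intervalIntegrable
    rw [uIcc_of_le zero_le_one]
    exact hg.comp (by fun_prop) fun x hx => ⟨htI, hx⟩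
  have hparts : ∫ x in (0 : ℝ)..1, A (t, x) * W (t, x) =
      A (t, 1) * Q (t, 1) - A (t, 0) * Q (t, 0) - ∫ x in (0 : ℝ)..1, A' (t, x) * Q (t, x) := by
    refine intervalIntegral.integral_mul_deriv_eq_deriv_mul (u := fun x => A (t, x))
      (v := fun x => Q (t, x)) (u' := fun x => A' (t, x)) (v' := fun x => W (t, x))
      (fun x hx => ?_) (fun x _ => ?_) (slice hA'c) (slice hWc)
    · rw [uIcc_of_le zero_le_one] at hx
      have hq : (t, x) ∈ Icc 0 T ×ˢ Icc (0 : ℝ) 1 := ⟨htI, hx⟩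
      have h1 := (hasDerivAt_snd_slice (hfd (t, x))).rpow_const (p := m - 1) (.inl (hf0 _ hq))
      have h3 := (hasDerivAt_snd_slice (hPd (t, x))).log (hP0 _ hq)
      rw [hexp] at h1
      refine (((h1.const_mul m).mul h3).const_mul σ).congr_deriv ?_
      change σ * (m * (P (t, x) * (m - 1) * f (t, x) ^ (m - 2)) * log (P (t, x)) +
        m * f (t, x) ^ (m - 1) * (Z (t, x) / P (t, x))) = A' (t, x)
      simp only [hA']
      ring
    · have h := hasDerivAt_snd_slice (hQd (t, x))
      rwa [fderiv_fderiv_apply_comm hu] at h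
  rw [(hBC t htI).1, (hBC t htI).2, mul_zero, mul_zero, sub_zero, zero_sub] at hparts
  have hAWi : IntervalIntegrable (fun x => A (t, x) * W (t, x)) MeasureTheory.volume 0 1 :=
    slice (hAc.mul hWc)
  have hA'Qi : IntervalIntegrable (fun x => A' (t, x) * Q (t, x)) MeasureTheory.volume 0 1 :=
    slice (hA'c.mul hQc)
  have hval : ∫ x in (0 : ℝ)..1, (B (t, x) + A (t, x) * W (t, x)) =
      -∫ x in (0 : ℝ)..1, Q (t, x) ^ 2 / |P (t, x)| := by
    rw [intervalIntegral.integral_add (slice hBc) hAWi, hparts, ← sub_eq_add_neg,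
      ← intervalIntegral.integral_sub (slice hBc) hA'Qi,
      ← intervalIntegral.integral_neg]
    refine intervalIntegral.integral_congr fun x hx => ?_
    rw [uIcc_of_le zero_le_one] at hx
    have hq : (t, x) ∈ Icc 0 T ×ˢ Icc (0 : ℝ) 1 := ⟨htI, hx⟩
    have h0 := hP0 _ hq
    have hpde : Q (t, x) = m * f (t, x) ^ (m - 1) * Z (t, x) +
      m * (m - 1) * f (t, x) ^ (m - 2) * P (t, x) ^ 2 := hPDE t htI x hx
    have hmain : B (t, x) - A' (t, x) * Q (t, x) = -(σ * (Q (t, x) * (m * f (t, x) ^ (m - 1) *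
        Z (t, x) + m * (m - 1) * f (t, x) ^ (m - 2) * P (t, x) ^ 2) / P (t, x))) := by
      simp only [hB, hA']
      field_simp
      ring
    change B (t, x) - A' (t, x) * Q (t, x) = -(Q (t, x) ^ 2 / |P (t, x)|)
    rw [hmain, ← hpde, habs _ hq]
    rcases hσ with rfl | rfl
    · rw [one_mul, one_mul, sq]
    · rw [neg_one_mul, neg_one_mul, div_neg, sq]
  rw [hval] at hleib
  refine hleib.congr_of_eventuallyEq ?_
  filter_upwards [Ioo_mem_nhds ht.1 ht.2] with s hs
  refine intervalIntegral.integral_congr fun x hx => ?_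
  rw [uIcc_of_le zero_le_one] at hx
  simp only [he, habs (s, x) ⟨Ioo_subset_Icc_self hs, hx⟩, ← log_abs (P (s, x))]
  rfl
end
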